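/- arXiv:1412.4697 — 4 statements merged into one kernel-verified Lean document; each statement's English description precedes it below -/
import Mathlib

section
/- Let u, Q, Qb, H : ℂ × ℂ → ℂ be C² functions of the independent complex variables (z, w). Define the matrix-valued functions V₁, V₂ : ℂ × ℂ → M₃(ℂ) by V₁ = [[∂u, 0, Q], [0, 0, (1/2)H·e^u], [−H, −2Q·e^{−u}, 0]] and V₂ = [[0, 0, (1/2)H·e^u], [0, ∂̄u, Qb], [−2Qb·e^{−u}, −H, 0]]. Then the zero-curvature condition ∂̄V₁ − ∂V₂ + V₁V₂ − V₂V₁ = 0 holds identically on ℂ × ℂ if and only if the three Gauss–Codazzi equations hold identically: ∂∂̄u + (1/2)H²e^u − 2Q·Qb·e^{−u} = 0, ∂Qb − (1/2)e^u·∂̄H = 0, and ∂̄Q − (1/2)e^u·∂H = 0. -/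
open Complex

/-- Partial derivative with respect to the first complex variable `z`. -/
noncomputable def pd1 (f : ℂ × ℂ → ℂ) (p : ℂ × ℂ) : ℂ :=
  deriv (fun z => f (z, p.2)) p.1

/-- Partial derivative with respect to the second complex variable `w` (playing the role of `z̄`). -/
noncomputable def pd2 (f : ℂ × ℂ → ℂ) (p : ℂ × ℂ) : ℂ :=
  deriv (fun w => f (p.1, w)) p.2

/-- Entrywise partial derivative of a matrix-valued function, first variable. -/
noncomputable def pdM1 (V : ℂ × ℂ → Matrix (Fin 3) (Fin 3) ℂ) (p : ℂ × ℂ) :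
    Matrix (Fin 3) (Fin 3) ℂ :=
  Matrix.of fun i j => pd1 (fun q => V q i j) p

/-- Entrywise partial derivative of a matrix-valued function, second variable. -/
noncomputable def pdM2 (V : ℂ × ℂ → Matrix (Fin 3) (Fin 3) ℂ) (p : ℂ × ℂ) :
    Matrix (Fin 3) (Fin 3) ℂ :=
  Matrix.of fun i j => pd2 (fun q => V q i j) p

/-- The Gauss–Weingarten matrix `V₁`. -/
noncomputable def Vone (u Q H : ℂ × ℂ → ℂ) (p : ℂ × ℂ) : Matrix (Fin 3) (Fin 3) ℂ :=
  !![pd1 u p, 0, Q p;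
     0, 0, (1/2) * H p * exp (u p);
     -H p, -2 * Q p * exp (-u p), 0]

/-- The Gauss–Weingarten matrix `V₂`. -/
noncomputable def Vtwo (u Qb H : ℂ × ℂ → ℂ) (p : ℂ × ℂ) : Matrix (Fin 3) (Fin 3) ℂ :=
  !![0, 0, (1/2) * H p * exp (u p);
     0, pd2 u p, Qb p;
     -2 * Qb p * exp (-u p), -H p, 0]

theorem hasDerivAt_comp_mk_left {f : ℂ × ℂ → ℂ} {p : ℂ × ℂ} (hf : DifferentiableAt ℂ f p) :
    HasDerivAt (fun z => f (z, p.2)) (fderiv ℂ f p (1, 0)) p.1 :=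
  hf.hasFDerivAt.comp_hasDerivAt (f := fun z => (z, p.2)) p.1
    ((hasDerivAt_id p.1).prodMk (hasDerivAt_const p.1 p.2))

theorem hasDerivAt_comp_mk_right {f : ℂ × ℂ → ℂ} {p : ℂ × ℂ} (hf : DifferentiableAt ℂ f p) :
    HasDerivAt (fun w => f (p.1, w)) (fderiv ℂ f p (0, 1)) p.2 :=
  hf.hasFDerivAt.comp_hasDerivAt (f := fun w => (p.1, w)) p.2
    ((hasDerivAt_const p.2 p.1).prodMk (hasDerivAt_id p.2))

theorem pd1_eq_fderiv {f : ℂ × ℂ → ℂ} {p : ℂ × ℂ} (hf : DifferentiableAt ℂ f p) :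
    pd1 f p = fderiv ℂ f p (1, 0) :=
  (hasDerivAt_comp_mk_left hf).deriv

theorem pd2_eq_fderiv {f : ℂ × ℂ → ℂ} {p : ℂ × ℂ} (hf : DifferentiableAt ℂ f p) :
    pd2 f p = fderiv ℂ f p (0, 1) :=
  (hasDerivAt_comp_mk_right hf).deriv

theorem hasDerivAt_pd1 {f : ℂ × ℂ → ℂ} (hf : Differentiable ℂ f) (p : ℂ × ℂ) :
    HasDerivAt (fun z => f (z, p.2)) (pd1 f p) p.1 :=
  (hasDerivAt_comp_mk_left (hf p)).differentiableAt.hasDerivAt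

theorem hasDerivAt_pd2 {f : ℂ × ℂ → ℂ} (hf : Differentiable ℂ f) (p : ℂ × ℂ) :
    HasDerivAt (fun w => f (p.1, w)) (pd2 f p) p.2 :=
  (hasDerivAt_comp_mk_right (hf p)).differentiableAt.hasDerivAt

/-- Mixed partial derivatives of a `C²` function commute. -/
theorem pd2_pd1_eq_pd1_pd2 {f : ℂ × ℂ → ℂ} (hf : ContDiff ℂ 2 f) (p : ℂ × ℂ) :
    pd2 (pd1 f) p = pd1 (pd2 f) p := by
  have hd : Differentiable ℂ f := hf.differentiable (by norm_num)
  have hd' : Differentiable ℂ (fderiv ℂ f) :=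
    (hf.fderiv_right (m := 1) (by norm_num)).differentiable (by norm_num)
  have key : ∀ v : ℂ × ℂ, HasFDerivAt (fun q => fderiv ℂ f q v)
      ((fderiv ℂ (fderiv ℂ f) p).flip v) p := fun v => by
    simpa using (hd' p).hasFDerivAt.clm_apply (hasFDerivAt_const v p)
  have hsymm : IsSymmSndFDerivAt ℂ f p :=
    hf.contDiffAt.isSymmSndFDerivAt (by simp)
  have h₁ : pd1 f = fun q => fderiv ℂ f q (1, 0) := funext fun q => pd1_eq_fderiv (hd q)
  have h₂ : pd2 f = fun q => fderiv ℂ f q (0, 1) := funext fun q => pd2_eq_fderiv (hd q)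
  rw [h₁, h₂, pd2_eq_fderiv (key _).differentiableAt, pd1_eq_fderiv (key _).differentiableAt,
    (key _).fderiv, (key _).fderiv]
  exact hsymm _ _

section Rules

variable {f g : ℂ × ℂ → ℂ}

theorem pd1_const (c : ℂ) (p : ℂ × ℂ) : pd1 (fun _ => c) p = 0 := by simp [pd1]

theorem pd2_const (c : ℂ) (p : ℂ × ℂ) : pd2 (fun _ => c) p = 0 := by simp [pd2]

theorem pd1_neg (p : ℂ × ℂ) : pd1 (fun q => -f q) p = -pd1 f p := deriv.fun_neg

theorem pd2_neg (p : ℂ × ℂ) : pd2 (fun q => -f q) p = -pd2 f p := deriv.fun_neg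

theorem pd1_const_mul_mul_exp (hf : Differentiable ℂ f) (hg : Differentiable ℂ g)
    (c : ℂ) (p : ℂ × ℂ) :
    pd1 (fun q => c * f q * exp (g q)) p
      = c * pd1 f p * exp (g p) + c * f p * (exp (g p) * pd1 g p) :=
  (((hasDerivAt_pd1 hf p).const_mul c).mul (hasDerivAt_pd1 hg p).cexp).deriv

theorem pd2_const_mul_mul_exp (hf : Differentiable ℂ f) (hg : Differentiable ℂ g)
    (c : ℂ) (p : ℂ × ℂ) :
    pd2 (fun q => c * f q * exp (g q)) p
      = c * pd2 f p * exp (g p) + c * f p * (exp (g p) * pd2 g p) :=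
  (((hasDerivAt_pd2 hf p).const_mul c).mul (hasDerivAt_pd2 hg p).cexp).deriv

end Rules

/-- The curvature of the pair `(Vone, Vtwo)`, written out entry by entry: each entry is either zero
or a multiple of the left-hand side of one of the Gauss–Codazzi equations. -/
theorem curvature_eq {u Q Qb H : ℂ × ℂ → ℂ} (hu : ContDiff ℂ 2 u) (hQ : Differentiable ℂ Q)
    (hQb : Differentiable ℂ Qb) (hH : Differentiable ℂ H) (p : ℂ × ℂ) :
    pdM2 (Vone u Q H) p - pdM1 (Vtwo u Qb H) p
        + Vone u Q H p * Vtwo u Qb H p - Vtwo u Qb H p * Vone u Q H p =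
      let G := pd1 (pd2 u) p + (1/2) * (H p)^2 * exp (u p) - 2 * Q p * Qb p * exp (-u p)
      let C₁ := pd1 Qb p - (1/2) * exp (u p) * pd2 H p
      let C₂ := pd2 Q p - (1/2) * exp (u p) * pd1 H p
      !![G, 0, C₂; 0, -G, -C₁; 2 * exp (-u p) * C₁, -2 * exp (-u p) * C₂, 0] := by
  have hud : Differentiable ℂ u := hu.differentiable (by norm_num)
  have hexp : exp (u p) * exp (-u p) = 1 := by rw [← exp_add]; simp
  ext i j
  simp only [Matrix.sub_apply, Matrix.add_apply, Matrix.mul_apply, Fin.sum_univ_three, pdM1, pdM2,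
    Matrix.of_apply]
  fin_cases i <;> fin_cases j <;>
    simp [Vone, Vtwo, pd1_const, pd2_const,
      pd1_neg, pd2_neg, -neg_mul, -one_div, pd1_const_mul_mul_exp hH hud,
      pd2_const_mul_mul_exp hH hud, pd1_const_mul_mul_exp hQb hud.fun_neg,
      pd2_const_mul_mul_exp hQ hud.fun_neg, pd2_pd1_eq_pd1_pd2 hu]
  all_goals grind

/-- The zero-curvature condition `∂̄V₁ − ∂V₂ + V₁V₂ − V₂V₁ = 0` holds identically iff the
three classical Gauss–Codazzi equations hold identically. -/
theorem zero_curvature_iff_gauss_codazzi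
    (u Q Qb H : ℂ × ℂ → ℂ)
    (hu : ContDiff ℂ 2 u) (hQ : ContDiff ℂ 2 Q) (hQb : ContDiff ℂ 2 Qb)
    (hH : ContDiff ℂ 2 H) :
    (∀ p : ℂ × ℂ,
      pdM2 (Vone u Q H) p - pdM1 (Vtwo u Qb H) p
        + Vone u Q H p * Vtwo u Qb H p - Vtwo u Qb H p * Vone u Q H p = 0)
    ↔
    (∀ p : ℂ × ℂ,
      pd1 (pd2 u) p + (1/2) * (H p)^2 * exp (u p) - 2 * Q p * Qb p * exp (-u p) = 0 ∧
      pd1 Qb p - (1/2) * exp (u p) * pd2 H p = 0 ∧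
      pd2 Q p - (1/2) * exp (u p) * pd1 H p = 0) := by
  refine forall_congr' fun p => ?_
  rw [curvature_eq hu (hQ.differentiable (by norm_num)) (hQb.differentiable (by norm_num))
    (hH.differentiable (by norm_num))]
  constructor
  · intro h
    refine ⟨?_, ?_, ?_⟩
    · simpa using congrFun₂ h 0 0
    · simpa using congrArg Neg.neg (congrFun₂ h 1 2)
    · simpa using congrFun₂ h 0 2
  · rintro ⟨hG, hC₁, hC₂⟩
    simp only [hG, hC₁, hC₂]
    ext i j
    fin_cases i <;> fin_cases j <;> simp
end

section
/- Let u, Q, Qb, H : ℂ × ℂ → ℂ be C² functions solving the Gauss–Codazzi system: ∂∂̄u + (1/2)H²e^u − 2Q·Qb·e^{−u} = 0, ∂Qb − (1/2)e^u·∂̄H = 0, ∂̄Q − (1/2)e^u·∂H = 0. Let g : ℂ → ℂ be an entire (holomorphic) function and let h : ℂ → ℂ be an entire function with exp(h(w)) = g′(w) for all w. Then the transformed functions ũ(z, w) = u(z, g(w)) + h(w), Q̃(z, w) = Q(z, g(w)), Q̃b(z, w) = g′(w)²·Qb(z, g(w)), H̃(z, w) = H(z, g(w)) also solve the Gauss–Codazzi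 system. (This is the finite conformal transformation in the second variable generated by the symmetry vector fields Y(ζ) = ζ(z̄)∂_{z̄} − 2ζ′(z̄)Qb∂_{Qb} − ζ′(z̄)U∂_U.) -/
open Complex

/-- The classical Gauss–Codazzi system for conformally parametrized surfaces in ℝ³. -/
def GaussCodazzi (u Q Qb H : ℂ × ℂ → ℂ) : Prop :=
  ∀ p : ℂ × ℂ,
    pd1 (pd2 u) p + (1/2) * (H p)^2 * exp (u p) - 2 * Q p * Qb p * exp (-u p) = 0 ∧
    pd1 Qb p - (1/2) * exp (u p) * pd2 H p = 0 ∧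
    pd2 Q p - (1/2) * exp (u p) * pd1 H p = 0

/-- A differentiable function of two variables is differentiable in the second one. -/
theorem differentiable_snd_slice {f : ℂ × ℂ → ℂ} (hf : Differentiable ℂ f) (z : ℂ) :
    Differentiable ℂ fun w => f (z, w) :=
  hf.comp ((differentiable_const z).prodMk differentiable_id)

/-- Chain rule for a substitution in the second variable. -/
theorem hasDerivAt_snd_comp {f : ℂ × ℂ → ℂ} (hf : Differentiable ℂ f) {g : ℂ → ℂ}
    (hg : Differentiable ℂ g) (z w : ℂ) :
    HasDerivAt (fun w => f (z, g w)) (pd2 f (z, g w) * deriv g w) w :=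
  HasDerivAt.comp w (differentiable_snd_slice hf z (g w)).hasDerivAt (hg w).hasDerivAt

/-- The finite conformal symmetry in the second variable, generated by
`Y(ζ) = ζ(z̄)∂_{z̄} − 2ζ′(z̄)Qb∂_{Qb} − ζ′(z̄)U∂_U`: if `(u, Q, Qb, H)` solves the Gauss–Codazzi
system, `g` is entire and `h` is an entire logarithm of `g′`, then
`(u(z, g w) + h w, Q(z, g w), g′(w)² Qb(z, g w), H(z, g w))` also solves it. -/
theorem gauss_codazzi_conformal_symmetry_second
    (u Q Qb H : ℂ × ℂ → ℂ)
    (hu : ContDiff ℂ 2 u) (hQ : ContDiff ℂ 2 Q) (hQb : ContDiff ℂ 2 Qb)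
    (hH : ContDiff ℂ 2 H)
    (hGC : GaussCodazzi u Q Qb H)
    (g h : ℂ → ℂ) (hg : Differentiable ℂ g) (hh : Differentiable ℂ h)
    (hgh : ∀ w : ℂ, exp (h w) = deriv g w) :
    GaussCodazzi (fun p => u (p.1, g p.2) + h p.2)
      (fun p => Q (p.1, g p.2))
      (fun p => (deriv g p.2)^2 * Qb (p.1, g p.2))
      (fun p => H (p.1, g p.2)) := by
  have hu' := hu.differentiable two_ne_zero
  have hQ' := hQ.differentiable two_ne_zero
  have hH' := hH.differentiable two_ne_zero
  have hpd2u : pd2 (fun p => u (p.1, g p.2) + h p.2) =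
      fun p => pd2 u (p.1, g p.2) * deriv g p.2 + deriv h p.2 := by
    funext p
    exact ((hasDerivAt_snd_comp hu' hg p.1 p.2).add (hh p.2).hasDerivAt).deriv
  rintro ⟨z, w⟩
  obtain ⟨gauss, codazzi₁, codazzi₂⟩ := hGC (z, g w)
  have hpd12u : pd1 (pd2 fun p => u (p.1, g p.2) + h p.2) (z, w) =
      pd1 (pd2 u) (z, g w) * deriv g w := by
    rw [hpd2u]
    simp only [pd1, deriv_add_const, deriv_mul_const_field]
  have hpd1Qb : pd1 (fun p => (deriv g p.2) ^ 2 * Qb (p.1, g p.2)) (z, w) =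
      (deriv g w) ^ 2 * pd1 Qb (z, g w) := by
    simp only [pd1, deriv_const_mul_field]
  have hpd2H : pd2 (fun p => H (p.1, g p.2)) (z, w) = pd2 H (z, g w) * deriv g w :=
    (hasDerivAt_snd_comp hH' hg z w).deriv
  have hpd2Q : pd2 (fun p => Q (p.1, g p.2)) (z, w) = pd2 Q (z, g w) * deriv g w :=
    (hasDerivAt_snd_comp hQ' hg z w).deriv
  have hpd1H : pd1 (fun p => H (p.1, g p.2)) (z, w) = pd1 H (z, g w) := rfl
  have hexp : exp (u (z, g w) + h w) = exp (u (z, g w)) * deriv g w := by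
    rw [exp_add, hgh]
  have hexp_neg : (deriv g w) ^ 2 * exp (-(u (z, g w) + h w)) =
      deriv g w * exp (-u (z, g w)) := by
    have hne : exp (h w) ≠ 0 := exp_ne_zero _
    rw [neg_add, exp_add, exp_neg (h w), ← hgh]
    field_simp
  refine ⟨?_, ?_, ?_⟩
  · rw [hpd12u]
    dsimp only
    rw [hexp]
    linear_combination deriv g w * gauss - 2 * Q (z, g w) * Qb (z, g w) * hexp_neg
  · rw [hpd1Qb, hpd2H]
    dsimp only
    rw [hexp]
    linear_combination (deriv g w) ^ 2 * codazzi₁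
  · rw [hpd2Q, hpd1H]
    dsimp only
    rw [hexp]
    linear_combination deriv g w * codazzi₂
end

section
/- For twice ℂ-differentiable functions η₁, η₂, ζ₁, ζ₂ : ℂ → ℂ, the symmetry vector fields of the classical Gauss–Codazzi equations close under the Lie bracket of vector fields in Witt-algebra (centerless Virasoro) fashion: [X(η₁), X(η₂)] = X(η₁η₂′ − η₁′η₂) and [Y(ζ₁), Y(ζ₂)] = Y(ζ₁ζ₂′ − ζ₁′ζ₂), where X(η) and Y(ζ) are the vector fields on ℂ⁶ defined in the context. -/
/-- The space ℂ⁶ with coordinates `(z, z̄, H, Q, Qb, U)`. -/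
abbrev C6 : Type := ℂ × ℂ × ℂ × ℂ × ℂ × ℂ

/-- The symmetry vector field `X(η) = η(z)∂_z − 2η′(z)Q∂_Q − η′(z)U∂_U` of the classical
Gauss–Codazzi equations, as a map ℂ⁶ → ℂ⁶ in the coordinates `(z, z̄, H, Q, Qb, U)`. -/
noncomputable def Xfield (η : ℂ → ℂ) (p : C6) : C6 :=
  (η p.1, 0, 0, -2 * deriv η p.1 * p.2.2.2.1, 0, -(deriv η p.1) * p.2.2.2.2.2)

/-- The symmetry vector field `Y(ζ) = ζ(z̄)∂_{z̄} − 2ζ′(z̄)Qb∂_{Qb} − ζ′(z̄)U∂_U` of the classical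
Gauss–Codazzi equations, as a map ℂ⁶ → ℂ⁶ in the coordinates `(z, z̄, H, Q, Qb, U)`. -/
noncomputable def Yfield (ζ : ℂ → ℂ) (p : C6) : C6 :=
  (0, ζ p.2.1, 0, 0, -2 * deriv ζ p.2.1 * p.2.2.2.2.1, -(deriv ζ p.2.1) * p.2.2.2.2.2)

/-- The Lie bracket of vector fields on ℂ⁶: `[V, W](p) = DW(p)·V(p) − DV(p)·W(p)`. -/
noncomputable def lieBracketVF (V W : C6 → C6) (p : C6) : C6 :=
  fderiv ℂ W p (V p) - fderiv ℂ V p (W p)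

theorem ContDiff.hasDerivAt_deriv {η : ℂ → ℂ} (hη : ContDiff ℂ 2 η) (z : ℂ) :
    HasDerivAt (deriv η) (deriv (deriv η) z) z := by
  have h : ContDiff ℂ (1 + 1) η := by rwa [one_add_one_eq_two]
  exact ((contDiff_succ_iff_deriv.mp h).2.2.differentiable one_ne_zero z).hasDerivAt

theorem ContDiff.hasDerivAt_self {η : ℂ → ℂ} (hη : ContDiff ℂ 2 η) (z : ℂ) :
    HasDerivAt η (deriv η z) z :=
  (hη.differentiable two_ne_zero z).hasDerivAt

theorem deriv_mul_deriv_sub_deriv_mul {η₁ η₂ : ℂ → ℂ} (hη₁ : ContDiff ℂ 2 η₁)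
    (hη₂ : ContDiff ℂ 2 η₂) (z : ℂ) :
    deriv (fun w => η₁ w * deriv η₂ w - deriv η₁ w * η₂ w) z
      = η₁ z * deriv (deriv η₂) z - deriv (deriv η₁) z * η₂ z := by
  have h := ((hη₁.hasDerivAt_self z).mul (hη₂.hasDerivAt_deriv z)).sub
    ((hη₁.hasDerivAt_deriv z).mul (hη₂.hasDerivAt_self z))
  refine h.deriv.trans ?_
  ring

theorem fderiv_Xfield_apply {η : ℂ → ℂ} (hη : ContDiff ℂ 2 η) (p v : C6) :
    fderiv ℂ (Xfield η) p v =
      (deriv η p.1 * v.1, 0, 0,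
        -2 * (deriv (deriv η) p.1 * v.1 * p.2.2.2.1 + deriv η p.1 * v.2.2.2.1), 0,
        -(deriv (deriv η) p.1 * v.1 * p.2.2.2.2.2 + deriv η p.1 * v.2.2.2.2.2)) := by
  have hz := hasFDerivAt_fst (𝕜 := ℂ) (p := p)
  have hs := hasFDerivAt_snd (𝕜 := ℂ) (p := p)
  have h0 := hasFDerivAt_const (𝕜 := ℂ) (0 : ℂ) p
  have h1 := (hη.hasDerivAt_self p.1).comp_hasFDerivAt p hz
  have h2 := (hη.hasDerivAt_deriv p.1).comp_hasFDerivAt p hz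
  have hQ := hs.snd.snd.fst
  have hU := hs.snd.snd.snd.snd
  have h := h1.prodMk (h0.prodMk (h0.prodMk
    (((h2.const_mul (-2)).mul hQ).prodMk (h0.prodMk (h2.neg.mul hU)))))
  have e : fderiv ℂ (Xfield η) p = _ := h.fderiv
  rw [e]
  ext <;> simp <;> ring

theorem fderiv_Yfield_apply {ζ : ℂ → ℂ} (hζ : ContDiff ℂ 2 ζ) (p v : C6) :
    fderiv ℂ (Yfield ζ) p v =
      (0, deriv ζ p.2.1 * v.2.1, 0, 0,
        -2 * (deriv (deriv ζ) p.2.1 * v.2.1 * p.2.2.2.2.1 + deriv ζ p.2.1 * v.2.2.2.2.1),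
        -(deriv (deriv ζ) p.2.1 * v.2.1 * p.2.2.2.2.2 + deriv ζ p.2.1 * v.2.2.2.2.2)) := by
  have hs := hasFDerivAt_snd (𝕜 := ℂ) (p := p)
  have h0 := hasFDerivAt_const (𝕜 := ℂ) (0 : ℂ) p
  have h1 := (hζ.hasDerivAt_self p.2.1).comp_hasFDerivAt p hs.fst
  have h2 := (hζ.hasDerivAt_deriv p.2.1).comp_hasFDerivAt p hs.fst
  have hQb := hs.snd.snd.snd.fst
  have hU := hs.snd.snd.snd.snd
  have h := h0.prodMk (h1.prodMk (h0.prodMk (h0.prodMk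
    (((h2.const_mul (-2)).mul hQb).prodMk (h2.neg.mul hU)))))
  have e : fderiv ℂ (Yfield ζ) p = _ := h.fderiv
  rw [e]
  ext <;> simp <;> ring

/-- Witt-algebra (centerless Virasoro) commutation relations for the symmetry vector fields of
the classical Gauss–Codazzi equations:
`[X(η₁), X(η₂)] = X(η₁η₂′ − η₁′η₂)` and `[Y(ζ₁), Y(ζ₂)] = Y(ζ₁ζ₂′ − ζ₁′ζ₂)`. -/
theorem gauss_codazzi_symmetry_witt_relations
    (η₁ η₂ ζ₁ ζ₂ : ℂ → ℂ)
    (hη₁ : ContDiff ℂ 2 η₁) (hη₂ : ContDiff ℂ 2 η₂)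
    (hζ₁ : ContDiff ℂ 2 ζ₁) (hζ₂ : ContDiff ℂ 2 ζ₂) :
    lieBracketVF (Xfield η₁) (Xfield η₂)
        = Xfield (fun z => η₁ z * deriv η₂ z - deriv η₁ z * η₂ z) ∧
    lieBracketVF (Yfield ζ₁) (Yfield ζ₂)
        = Yfield (fun zb => ζ₁ zb * deriv ζ₂ zb - deriv ζ₁ zb * ζ₂ zb) := by
  constructor <;> funext p
  · rw [lieBracketVF, fderiv_Xfield_apply hη₁, fderiv_Xfield_apply hη₂]
    simp only [Xfield, deriv_mul_deriv_sub_deriv_mul hη₁ hη₂, Prod.mk_sub_mk, Prod.mk.injEq]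
    refine ⟨?_, ?_, ?_, ?_, ?_, ?_⟩ <;> ring
  · rw [lieBracketVF, fderiv_Yfield_apply hζ₁, fderiv_Yfield_apply hζ₂]
    simp only [Yfield, deriv_mul_deriv_sub_deriv_mul hζ₁ hζ₂, Prod.mk_sub_mk, Prod.mk.injEq]
    refine ⟨?_, ?_, ?_, ?_, ?_, ?_⟩ <;> ring
end

section
/- For twice ℂ-differentiable functions η, ζ : ℂ → ℂ, the symmetry vector fields of the classical Gauss–Codazzi equations satisfy the commutation relations [X(η), Y(ζ)] = 0, [X(η), e₀] = 0 and [Y(ζ), e₀] = 0, where X(η), Y(ζ) and e₀ are the vector fields on ℂ⁶ defined in the context and [·,·] is the Lie bracket of vector fields. In particular, e₀ is central and the symmetry algebra decomposes as a direct sum {X(η)} ⊕ {Y(ζ)} ⊕ {e₀}. -/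
/-- The central symmetry vector field `e₀ = −H∂_H + Q∂_Q + Qb∂_{Qb} + 2U∂_U`. -/
def e0field (p : C6) : C6 :=
  (0, 0, -p.2.2.1, p.2.2.2.1, p.2.2.2.2.1, 2 * p.2.2.2.2.2)

theorem ContDiff.hasDerivAt_deriv_of_two {f : ℂ → ℂ} (hf : ContDiff ℂ 2 f) (z : ℂ) :
    HasDerivAt (deriv f) (deriv (deriv f) z) z :=
  ((hf.differentiable_deriv_two) z).hasDerivAt

theorem hasFDerivAt_snd_snd_snd (p : C6) :
    HasFDerivAt (fun q : C6 => q.2.2.2)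
      ((ContinuousLinearMap.snd ℂ ℂ (ℂ × ℂ × ℂ)).comp
        ((ContinuousLinearMap.snd ℂ ℂ (ℂ × ℂ × ℂ × ℂ)).comp
          (ContinuousLinearMap.snd ℂ ℂ (ℂ × ℂ × ℂ × ℂ × ℂ)))) p :=
  hasFDerivAt_snd.snd.snd

theorem fderiv_Xfield {η : ℂ → ℂ} (hη : ContDiff ℂ 2 η) (p v : C6) :
    fderiv ℂ (Xfield η) p v =
      (deriv η p.1 * v.1, 0, 0,
        -2 * deriv η p.1 * v.2.2.2.1 - 2 * deriv (deriv η) p.1 * v.1 * p.2.2.2.1, 0,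
        -(deriv η p.1) * v.2.2.2.2.2 - deriv (deriv η) p.1 * v.1 * p.2.2.2.2.2) := by
  have hz := hasFDerivAt_fst (𝕜 := ℂ) (p := p)
  have h0 := ((hη.differentiable two_ne_zero) p.1).hasDerivAt.comp_hasFDerivAt p hz
  have h1 := (hη.hasDerivAt_deriv_of_two p.1).comp_hasFDerivAt p hz
  have hr := hasFDerivAt_snd_snd_snd p
  have h := h0.prodMk <| (hasFDerivAt_const (0 : ℂ) p).prodMk <|
    (hasFDerivAt_const (0 : ℂ) p).prodMk <| ((h1.const_mul (-2)).mul hr.fst).prodMk <|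
    (hasFDerivAt_const (0 : ℂ) p).prodMk (h1.neg.mul hr.snd.snd)
  rw [show fderiv ℂ (Xfield η) p = _ from h.fderiv]
  simp
  constructor <;> ring

theorem fderiv_Yfield {ζ : ℂ → ℂ} (hζ : ContDiff ℂ 2 ζ) (p v : C6) :
    fderiv ℂ (Yfield ζ) p v =
      (0, deriv ζ p.2.1 * v.2.1, 0, 0,
        -2 * deriv ζ p.2.1 * v.2.2.2.2.1 - 2 * deriv (deriv ζ) p.2.1 * v.2.1 * p.2.2.2.2.1,
        -(deriv ζ p.2.1) * v.2.2.2.2.2 - deriv (deriv ζ) p.2.1 * v.2.1 * p.2.2.2.2.2) := by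
  have hz := (hasFDerivAt_snd (𝕜 := ℂ) (p := p)).fst
  have h0 := ((hζ.differentiable two_ne_zero) p.2.1).hasDerivAt.comp_hasFDerivAt p hz
  have h1 := (hζ.hasDerivAt_deriv_of_two p.2.1).comp_hasFDerivAt p hz
  have hr := hasFDerivAt_snd_snd_snd p
  have h := (hasFDerivAt_const (0 : ℂ) p).prodMk <| h0.prodMk <|
    (hasFDerivAt_const (0 : ℂ) p).prodMk <| (hasFDerivAt_const (0 : ℂ) p).prodMk <|
    ((h1.const_mul (-2)).mul hr.snd.fst).prodMk (h1.neg.mul hr.snd.snd)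
  rw [show fderiv ℂ (Yfield ζ) p = _ from h.fderiv]
  simp
  constructor <;> ring

theorem fderiv_e0field (p v : C6) : fderiv ℂ e0field p v = e0field v := by
  have hH := (hasFDerivAt_snd (𝕜 := ℂ) (p := p)).snd.fst
  have hr := hasFDerivAt_snd_snd_snd p
  have h := (hasFDerivAt_const (0 : ℂ) p).prodMk <| (hasFDerivAt_const (0 : ℂ) p).prodMk <|
    hH.neg.prodMk <| hr.fst.prodMk <| hr.snd.fst.prodMk (hr.snd.snd.const_mul 2)
  rw [show fderiv ℂ e0field p = _ from h.fderiv]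
  simp [e0field]

/-- The symmetry vector fields of the classical Gauss–Codazzi equations satisfy
`[X(η), Y(ζ)] = 0`, `[X(η), e₀] = 0` and `[Y(ζ), e₀] = 0`; in particular `e₀` is central and
the symmetry algebra decomposes as the direct sum `{X(η)} ⊕ {Y(ζ)} ⊕ {e₀}`. -/
theorem gauss_codazzi_symmetry_commuting_relations
    (η ζ : ℂ → ℂ) (hη : ContDiff ℂ 2 η) (hζ : ContDiff ℂ 2 ζ) :
    (lieBracketVF (Xfield η) (Yfield ζ) = fun _ => (0 : C6)) ∧
    (lieBracketVF (Xfield η) e0field = fun _ => (0 : C6)) ∧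
    (lieBracketVF (Yfield ζ) e0field = fun _ => (0 : C6)) := by
  refine ⟨?_, ?_, ?_⟩ <;> funext p
  · rw [lieBracketVF, fderiv_Xfield hη, fderiv_Yfield hζ]
    simp [Xfield, Yfield]
    ring
  · rw [lieBracketVF, fderiv_Xfield hη, fderiv_e0field]
    simp [Xfield, e0field]
    ring
  · rw [lieBracketVF, fderiv_Yfield hζ, fderiv_e0field]
    simp [Yfield, e0field]
    ring
end
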